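/- The series ∑_{k ≥ 1} M_k^{−1/(2k)} diverges, where M_k = ∑_{m ≥ 1} (Λ^{*k}(m))²/m². (This is Carleman's condition for the moment sequence (M_k).) -/

import Mathlib

open ArithmeticFunction

/-- `Λ^{*k}`, the `k`-fold Dirichlet convolution of the von Mangoldt function
with itself, realized as the `k`-th power of `Λ` in the ring of arithmetic
functions (whose multiplication is Dirichlet convolution). -/
noncomputable def vonMangoldtConv (k : ℕ) : ArithmeticFunction ℝ := vonMangoldt ^ k

/-- `M_k = ∑_{m ≥ 1} (Λ^{*k}(m))² / m²`. -/
noncomputable def momentConst (k : ℕ) : ℝ :=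
  ∑' m : ℕ, (vonMangoldtConv k m) ^ 2 / (m : ℝ) ^ 2

lemma vmc_nonneg (k m : ℕ) : 0 ≤ vonMangoldtConv k m := by
  unfold vonMangoldtConv
  induction k generalizing m with
  | zero => rw [pow_zero, ArithmeticFunction.one_apply]; split_ifs <;> norm_num
  | succ k ih =>
    rw [pow_succ, ArithmeticFunction.mul_apply]
    exact Finset.sum_nonneg fun x _ => mul_nonneg (ih _) vonMangoldt_nonneg

lemma vmc_le (k m : ℕ) : vonMangoldtConv k m ≤ Real.log m ^ k := by
  induction k generalizing m with
  | zero =>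
    unfold vonMangoldtConv
    rw [pow_zero, ArithmeticFunction.one_apply, pow_zero]; split_ifs <;> norm_num
  | succ k ih =>
    have h : vonMangoldtConv (k+1) m =
        ∑ x ∈ m.divisorsAntidiagonal, vonMangoldtConv k x.1 * vonMangoldt x.2 := by
      unfold vonMangoldtConv
      rw [pow_succ, ArithmeticFunction.mul_apply]
    have hl : Real.log m = ∑ x ∈ m.divisorsAntidiagonal, vonMangoldt x.2 := by
      rw [← vonMangoldt_sum,
        Nat.sum_divisorsAntidiagonal' (f := fun _ d => vonMangoldt d)]
    have hp : Real.log m ^ (k+1) =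
        ∑ x ∈ m.divisorsAntidiagonal, Real.log m ^ k * vonMangoldt x.2 := by
      rw [← Finset.mul_sum, ← hl, pow_succ]
    rw [h, hp]
    refine Finset.sum_le_sum fun x hx => ?_
    refine mul_le_mul_of_nonneg_right ((ih x.1).trans ?_) vonMangoldt_nonneg
    obtain ⟨h1, h2⟩ := Nat.mem_divisorsAntidiagonal.1 hx
    have hd : x.1 ∣ m := ⟨x.2, h1.symm⟩
    have hp : 0 < x.1 := Nat.pos_of_dvd_of_pos hd (Nat.pos_of_ne_zero h2)
    have hle : x.1 ≤ m := Nat.le_of_dvd (Nat.pos_of_ne_zero h2) hd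
    refine pow_le_pow_left₀ (Real.log_natCast_nonneg _) ?_ k
    exact Real.log_le_log (by exact_mod_cast hp) (by exact_mod_cast hle)

lemma vmc_two_pow_pos (k : ℕ) : 0 < vonMangoldtConv k (2 ^ k) := by
  induction k with
  | zero => simp [vonMangoldtConv]
  | succ k ih =>
    have h : vonMangoldtConv (k+1) (2^(k+1)) =
        ∑ x ∈ (2^(k+1)).divisorsAntidiagonal, vonMangoldtConv k x.1 * vonMangoldt x.2 := by
      unfold vonMangoldtConv
      rw [pow_succ, ArithmeticFunction.mul_apply]
    rw [h]
    refine Finset.sum_pos' (fun x _ => mul_nonneg (vmc_nonneg _ _) vonMangoldt_nonneg)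
      ⟨(2^k, 2), ?_, ?_⟩
    · simp [Nat.mem_divisorsAntidiagonal, pow_succ]
    · refine mul_pos ih ?_
      rw [vonMangoldt_apply_prime Nat.prime_two]
      exact Real.log_pos (by norm_num)

lemma term_le (k m : ℕ) : (vonMangoldtConv k m) ^ 2 / (m : ℝ) ^ 2 ≤
    (4 * (k:ℝ)) ^ (2 * k) * (1 / (m : ℝ) ^ (3/2 : ℝ)) := by
  rcases Nat.eq_zero_or_pos m with rfl | hm
  · simp
  have hm' : (0:ℝ) < m := by exact_mod_cast hm
  have hlog : 0 ≤ Real.log m := Real.log_natCast_nonneg _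
  have h1 : (vonMangoldtConv k m) ^ 2 ≤ Real.log m ^ (2 * k) := by
    rw [mul_comm, pow_mul]
    exact pow_le_pow_left₀ (vmc_nonneg _ _) (vmc_le _ _) 2
  have h2 : (Real.log m / 2) ^ (2*k) / ((2*k).factorial : ℝ) ≤ (m:ℝ) ^ (1/2 : ℝ) := by
    rw [Real.rpow_def_of_pos hm', ← div_eq_mul_one_div]
    exact Real.pow_div_factorial_le_exp _ (by positivity) _
  have h3 : ((2*k).factorial : ℝ) ≤ (2 * (k:ℝ)) ^ (2*k) := by
    exact_mod_cast Nat.factorial_le_pow (2*k)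
  have h4 : Real.log m ^ (2*k) ≤ (4 * (k:ℝ)) ^ (2 * k) * (m:ℝ) ^ (1/2 : ℝ) := by
    rw [div_le_iff₀ (by positivity)] at h2
    calc Real.log m ^ (2*k) = 2 ^ (2*k) * (Real.log m / 2) ^ (2*k) := by
          rw [← mul_pow]; congr 1; ring
      _ ≤ 2 ^ (2*k) * ((m:ℝ) ^ (1/2 : ℝ) * (2 * (k:ℝ)) ^ (2*k)) := by
          gcongr
          exact h2.trans (by gcongr)
      _ = _ := by
          rw [show (4 * (k:ℝ)) = 2 * (2 * k) by ring, mul_pow 2 (2 * (k:ℝ))]; ring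
  have h5 : (m:ℝ) ^ 2 = (m:ℝ) ^ (1/2 : ℝ) * (m:ℝ) ^ (3/2 : ℝ) := by
    rw [← Real.rpow_add hm', ← Real.rpow_natCast]; norm_num
  calc _ ≤ (4 * (k:ℝ)) ^ (2 * k) * (m:ℝ) ^ (1/2 : ℝ) / (m:ℝ)^2 := by
        gcongr; exact h1.trans h4
    _ = _ := by
        have : (m:ℝ) ^ (1/2 : ℝ) ≠ 0 := (Real.rpow_pos_of_pos hm' _).ne'
        have : (m:ℝ) ^ (3/2 : ℝ) ≠ 0 := (Real.rpow_pos_of_pos hm' _).ne'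
        rw [h5]; field_simp

lemma summable_S : Summable fun m : ℕ => 1 / (m : ℝ) ^ (3/2 : ℝ) :=
  Real.summable_one_div_nat_rpow.2 (by norm_num)

lemma summable_term (k : ℕ) :
    Summable fun m : ℕ => (vonMangoldtConv k m) ^ 2 / (m : ℝ) ^ 2 :=
  Summable.of_nonneg_of_le (fun m => by positivity) (term_le k)
    (summable_S.mul_left _)

lemma momentConst_pos (k : ℕ) : 0 < momentConst k := by
  refine (summable_term k).tsum_pos (fun m => by positivity) (2^k) ?_
  have := vmc_two_pow_pos k
  positivity

lemma momentConst_le (k : ℕ) : momentConst k ≤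
    (4 * (k:ℝ)) ^ (2 * k) * ∑' m : ℕ, 1 / (m : ℝ) ^ (3/2 : ℝ) := by
  rw [← tsum_mul_left]
  exact (summable_term k).tsum_le_tsum (term_le k) (summable_S.mul_left _)

/-- **Carleman's condition.** The series
`∑_{k ≥ 1} M_k^{-1/(2k)}` diverges. -/
theorem carleman_condition :
    ¬ Summable (fun k : ℕ =>
      momentConst (k + 1) ^ (-(1 : ℝ) / (2 * ((k : ℝ) + 1)))) := by
  intro hs
  obtain ⟨S, hS⟩ : ∃ S : ℝ, S = ∑' m : ℕ, 1 / (m : ℝ) ^ (3/2 : ℝ) := ⟨_, rfl⟩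
  have hS1 : 1 ≤ S := by
    rw [hS]
    simpa using summable_S.le_tsum 1 (fun m _ => by positivity)
  have key : ∀ k : ℕ, (4 * S)⁻¹ * (1 / ((k + 1 : ℕ) : ℝ)) ≤
      momentConst (k + 1) ^ (-(1 : ℝ) / (2 * ((k : ℝ) + 1))) := by
    intro k
    have hB : 0 < 4 * ((k + 1 : ℕ) : ℝ) * S := by positivity
    have hle : momentConst (k+1) ≤ (4 * ((k + 1 : ℕ) : ℝ) * S) ^ (2 * (k+1)) := by
      refine (momentConst_le (k+1)).trans ?_
      rw [← hS, mul_pow _ S]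
      gcongr
      exact le_self_pow₀ hS1 (by omega)
    have h := Real.rpow_le_rpow_of_nonpos (momentConst_pos (k+1)) hle
      (z := -(1 : ℝ) / (2 * ((k : ℝ) + 1)))
      (div_nonpos_of_nonpos_of_nonneg (by norm_num) (by positivity))
    refine le_trans (le_of_eq ?_) h
    rw [← Real.rpow_natCast, ← Real.rpow_mul hB.le]
    have : ((2 * (k+1) : ℕ) : ℝ) * (-(1 : ℝ) / (2 * ((k : ℝ) + 1))) = -1 := by
      push_cast
      have : (k:ℝ) + 1 ≠ 0 := by positivity
      field_simp
    rw [this, Real.rpow_neg_one]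
    rw [one_div, ← mul_inv]; congr 1; ring
  have h1 : Summable fun k : ℕ => (4 * S)⁻¹ * (1 / ((k + 1 : ℕ) : ℝ)) :=
    Summable.of_nonneg_of_le (fun k => by positivity) key hs
  rw [summable_mul_left_iff (by positivity)] at h1
  exact Real.not_summable_one_div_natCast
    ((summable_nat_add_iff (f := fun n : ℕ => 1 / (n : ℝ)) 1).1 h1)
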